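/- arXiv:1708.00582 — 4 statements merged into one kernel-verified Lean document; each statement's English description precedes it below -/
import Mathlib

section
/- Let G=(V,E) be a finite simple undirected graph, U ⊆ 2^V a family of vertex subsets, t a positive integer, F ⊆ E a U-feasible t-matching, and X ⊆ V an arbitrary vertex subset. Then |F| ≤ t·|X| + |E[C_{V∖X}]| + Σ_{U ∈ U_{V∖X}} ⌊(t|U|−1)/2⌋. -/
open scoped Classical

noncomputable section

variable {V : Type*} [Fintype V] [DecidableEq V]

/-- `deg_F(v)`: the number of edges of `F` incident to the vertex `v`. -/
def degF (F : Finset (Sym2 V)) (v : V) : ℕ := (F.filter (fun e => v ∈ e)).card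

/-- `F[X]`: the set of edges of `F` with both endpoints in `X`. -/
def inducedEdges (F : Finset (Sym2 V)) (X : Finset V) : Finset (Sym2 V) :=
  F.filter (fun e => ∀ v ∈ e, v ∈ X)

/-- `F[X,Y]`: the set of edges of `F` with one endpoint in `X` and the other in `Y`. -/
def crossEdges (F : Finset (Sym2 V)) (X Y : Finset V) : Finset (Sym2 V) :=
  F.filter (fun e => ∃ u ∈ X, ∃ v ∈ Y, e = s(u, v))

/-- `F` is a `t`-matching: every vertex is incident to at most `t` edges of `F`. -/
def IsTMatching (F : Finset (Sym2 V)) (t : ℕ) : Prop := ∀ v : V, degF F v ≤ t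

/-- `F[U]` is a `t`-factor of the induced subgraph on `U`:
every vertex of `U` is incident to exactly `t` edges of `F[U]`. -/
def IsTFactorOn (F : Finset (Sym2 V)) (U : Finset V) (t : ℕ) : Prop :=
  ∀ v ∈ U, degF (inducedEdges F U) v = t

/-- `⌊(t·|U| - 1)/2⌋` as an integer. -/
def ufBound (t : ℕ) (U : Finset V) : ℤ := ⌊((t * U.card - 1 : ℚ) / 2)⌋

/-- A `t`-matching `F` is `𝒰`-feasible if `|F[U]| ≤ ⌊(t·|U| - 1)/2⌋` for every `U ∈ 𝒰`. -/
def IsUFeasible (F : Finset (Sym2 V)) (𝒰 : Finset (Finset V)) (t : ℕ) : Prop :=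
  ∀ U ∈ 𝒰, ((inducedEdges F U).card : ℤ) ≤ ufBound t U

/-- `U` is the vertex set of a connected component of the induced subgraph `G[X]`. -/
def IsComponentOf (G : SimpleGraph V) (X U : Finset V) : Prop :=
  U.Nonempty ∧ U ⊆ X ∧ (G.induce (↑U : Set V)).Connected ∧
    ∀ u ∈ U, ∀ v ∈ X, G.Adj u v → v ∈ U

/-- `𝒰_X`: the members of `𝒰` that form connected components of `G[X]`. -/
def compFamily (G : SimpleGraph V) (𝒰 : Finset (Finset V)) (X : Finset V) :
    Finset (Finset V) :=
  𝒰.filter (fun U => IsComponentOf G X U)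

/-- `C_X = X \ ⋃_{U ∈ 𝒰_X} U`. -/
def freeVertices (G : SimpleGraph V) (𝒰 : Finset (Finset V)) (X : Finset V) : Finset V :=
  X \ (compFamily G 𝒰 X).sup id

/-- Every edge of `F` touches `X`, or lies inside the free vertices of `Xᶜ`, or lies inside a
member of `𝒰` that is a component of `G[Xᶜ]`. -/
theorem subset_biUnion_union_inducedEdges (G : SimpleGraph V) (𝒰 : Finset (Finset V))
    (F : Finset (Sym2 V)) (hFE : F ⊆ G.edgeFinset) (X : Finset V) :
    F ⊆ (X.biUnion fun v => F.filter (fun e => v ∈ e))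
      ∪ inducedEdges G.edgeFinset (freeVertices G 𝒰 Xᶜ)
      ∪ (compFamily G 𝒰 Xᶜ).biUnion (inducedEdges F) := by
  intro e he
  have hadj := hFE he
  induction e using Sym2.ind with
  | _ a b =>
    have hab : G.Adj a b := by simpa using hadj
    simp only [Finset.mem_union, Finset.mem_biUnion, Finset.mem_filter, inducedEdges,
      Sym2.mem_iff, forall_eq_or_imp, forall_eq]
    by_cases ha : a ∈ X
    · exact Or.inl (Or.inl ⟨a, ha, he, Or.inl rfl⟩)
    by_cases hb : b ∈ X
    · exact Or.inl (Or.inl ⟨b, hb, he, Or.inr rfl⟩)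
    by_cases hU : ∃ U ∈ compFamily G 𝒰 Xᶜ, a ∈ U ∨ b ∈ U
    · obtain ⟨U, hU, h⟩ := hU
      have hcl := (Finset.mem_filter.mp hU).2.2.2.2
      refine Or.inr ⟨U, hU, he, ?_⟩
      rcases h with h | h
      · exact ⟨h, hcl a h b (Finset.mem_compl.mpr hb) hab⟩
      · exact ⟨hcl b h a (Finset.mem_compl.mpr ha) hab.symm, h⟩
    · push Not at hU
      refine Or.inl (Or.inr ⟨hadj, ?_, ?_⟩) <;>
        simp only [freeVertices, Finset.mem_sdiff, Finset.mem_compl, Finset.mem_sup, id]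
      · exact ⟨ha, fun ⟨U, hU', h⟩ => (hU U hU').1 h⟩
      · exact ⟨hb, fun ⟨U, hU', h⟩ => (hU U hU').2 h⟩

/-- **Weak duality** (Lemma 1): for every `𝒰`-feasible `t`-matching `F ⊆ E` and every `X ⊆ V`,
`|F| ≤ t·|X| + |E[C_{V∖X}]| + Σ_{U ∈ 𝒰_{V∖X}} ⌊(t·|U|−1)/2⌋`. -/
theorem weak_duality (G : SimpleGraph V) (𝒰 : Finset (Finset V)) (t : ℕ) (ht : 0 < t)
    (F : Finset (Sym2 V)) (hFE : F ⊆ G.edgeFinset)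
    (hFmatch : IsTMatching F t) (hFfeas : IsUFeasible F 𝒰 t) (X : Finset V) :
    (F.card : ℤ) ≤ t * X.card
      + (inducedEdges G.edgeFinset (freeVertices G 𝒰 Xᶜ)).card
      + ∑ U ∈ compFamily G 𝒰 Xᶜ, ufBound t U := by
  have hcard := (Finset.card_le_card (subset_biUnion_union_inducedEdges G 𝒰 F hFE X)).trans
    ((Finset.card_union_le _ _).trans (Nat.add_le_add_right (Finset.card_union_le _ _) _))
  have hX : (X.biUnion fun v => F.filter (fun e => v ∈ e)).card ≤ X.card * t :=
    Finset.card_biUnion_le_card_mul _ _ _ fun v _ => hFmatch v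
  have hU : (((compFamily G 𝒰 Xᶜ).biUnion (inducedEdges F)).card : ℤ)
      ≤ ∑ U ∈ compFamily G 𝒰 Xᶜ, ufBound t U := by
    refine le_trans (Nat.cast_le.mpr Finset.card_biUnion_le) ?_
    rw [Nat.cast_sum]
    exact Finset.sum_le_sum fun U hU => hFfeas U (Finset.mem_filter.mp hU).1
  zify at hcard hX
  linarith
end
end

section
/- Let G=(V,E) be a finite simple undirected graph, U ⊆ 2^V a family of vertex subsets, t a positive integer, F ⊆ E a U-feasible t-matching, and X ⊆ V. Then |F[V∖X]| ≤ |E[C_{V∖X}]| + Σ_{U ∈ U_{V∖X}} ⌊(t|U|−1)/2⌋. -/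
open scoped Classical

noncomputable section

variable {V : Type*} [Fintype V] [DecidableEq V]

/-- Every edge of `F[Y]` lies in `E[C_Y]` or in `F[U]` for some `U ∈ 𝒰_Y`. -/
theorem inducedEdges_subset_union_biUnion (G : SimpleGraph V) (𝒰 : Finset (Finset V))
    (F : Finset (Sym2 V)) (hFE : F ⊆ G.edgeFinset) (Y : Finset V) :
    inducedEdges F Y ⊆ inducedEdges G.edgeFinset (freeVertices G 𝒰 Y) ∪
      (compFamily G 𝒰 Y).biUnion (inducedEdges F) := by
  intro e he
  obtain ⟨heF, heY⟩ := Finset.mem_filter.mp he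
  have heG := hFE heF
  rw [Finset.mem_union, Finset.mem_biUnion]
  by_cases h : ∃ U ∈ compFamily G 𝒰 Y, ∃ u ∈ e, u ∈ U
  · obtain ⟨U, hU, u, hue, huU⟩ := h
    refine Or.inr ⟨U, hU, Finset.mem_filter.mpr ⟨heF, fun v hv => ?_⟩⟩
    obtain ⟨w, rfl⟩ := Sym2.mem_iff_exists.mp hue
    have hadj : G.Adj u w := by simpa using heG
    rcases Sym2.mem_iff.mp hv with rfl | rfl
    · exact huU
    · exact (Finset.mem_filter.mp hU).2.2.2.2 u huU v (heY v hv) hadj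
  · push Not at h
    refine Or.inl (Finset.mem_filter.mpr ⟨heG, fun v hv => ?_⟩)
    refine Finset.mem_sdiff.mpr ⟨heY v hv, fun hsup => ?_⟩
    obtain ⟨U, hU, hvU⟩ := Finset.mem_sup.mp hsup
    exact h U hU v hv hvU

/-- For a `𝒰`-feasible `t`-matching `F` and any `X ⊆ V`:
`|F[V∖X]| ≤ |E[C_{V∖X}]| + Σ_{U ∈ 𝒰_{V∖X}} ⌊(t·|U|−1)/2⌋`. -/
theorem feasible_bound_on_complement (G : SimpleGraph V) (𝒰 : Finset (Finset V))
    (t : ℕ) (ht : 0 < t)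
    (F : Finset (Sym2 V)) (hFE : F ⊆ G.edgeFinset)
    (hFmatch : IsTMatching F t) (hFfeas : IsUFeasible F 𝒰 t) (X : Finset V) :
    ((inducedEdges F Xᶜ).card : ℤ)
      ≤ (inducedEdges G.edgeFinset (freeVertices G 𝒰 Xᶜ)).card
        + ∑ U ∈ compFamily G 𝒰 Xᶜ, ufBound t U := by
  have hsub : inducedEdges F Xᶜ ⊆ inducedEdges G.edgeFinset (freeVertices G 𝒰 Xᶜ) ∪
      (compFamily G 𝒰 Xᶜ).biUnion (inducedEdges F) :=
    inducedEdges_subset_union_biUnion G 𝒰 F hFE Xᶜ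
  have hcard : (inducedEdges F Xᶜ).card ≤
      (inducedEdges G.edgeFinset (freeVertices G 𝒰 Xᶜ)).card +
        ∑ U ∈ compFamily G 𝒰 Xᶜ, (inducedEdges F U).card :=
    (Finset.card_le_card hsub).trans <| (Finset.card_union_le _ _).trans <|
      Nat.add_le_add_left Finset.card_biUnion_le _
  have hsum : ∑ U ∈ compFamily G 𝒰 Xᶜ, ((inducedEdges F U).card : ℤ) ≤
      ∑ U ∈ compFamily G 𝒰 Xᶜ, ufBound t U :=
    Finset.sum_le_sum fun U hU => hFfeas U (Finset.mem_filter.mp hU).1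
  have hcast : ((inducedEdges F Xᶜ).card : ℤ) ≤
      (inducedEdges G.edgeFinset (freeVertices G 𝒰 Xᶜ)).card +
        ∑ U ∈ compFamily G 𝒰 Xᶜ, ((inducedEdges F U).card : ℤ) := by
    exact_mod_cast hcard
  linarith
end
end

section
/- Let G=(V,E) be a finite simple undirected graph with edge weights w : E → ℝ, and let D=(V,A) be the digraph with A = {(u,v),(v,u) : {u,v} ∈ E} and arc weights w'((u,v)) = w'((v,u)) = w({u,v}). Then for every even factor F ⊆ A of D there exists a matching M ⊆ E of G with w(M) ≥ w'(F)/2. -/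
open scoped Classical

noncomputable section

variable {V : Type*} [Fintype V] [DecidableEq V]

/-- The number of arcs of `F` leaving `v`. -/
def outDeg (F : Finset (V × V)) (v : V) : ℕ := (F.filter (fun a => a.1 = v)).card

/-- The number of arcs of `F` entering `v`. -/
def inDeg (F : Finset (V × V)) (v : V) : ℕ := (F.filter (fun a => a.2 = v)).card

/-- `F` is a path-cycle factor: every vertex has at most one outgoing and
at most one incoming arc in `F`. -/
def IsPathCycleFactor (F : Finset (V × V)) : Prop :=
  ∀ v : V, outDeg F v ≤ 1 ∧ inDeg F v ≤ 1

/-- `F` contains a directed cycle of odd length: there are `k > 0` odd and distinct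
vertices `c 0, …, c (k-1)` with `(c i, c (i+1)) ∈ F` cyclically. -/
def HasOddDicycle (F : Finset (V × V)) : Prop :=
  ∃ (k : ℕ) (c : ZMod k → V), 0 < k ∧ Odd k ∧ Function.Injective c ∧
    ∀ i : ZMod k, (c i, c (i + 1)) ∈ F

/-- `F` is an even factor: a path-cycle factor with no odd directed cycle. -/
def IsEvenFactor (F : Finset (V × V)) : Prop :=
  IsPathCycleFactor F ∧ ¬ HasOddDicycle F

/-- The arc set `A = {(u,v), (v,u) : {u,v} ∈ E}` of the digraph obtained from `G`
by replacing every edge with the two oppositely directed arcs. -/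
def digraphArcs (G : SimpleGraph V) : Finset (V × V) :=
  Finset.univ.filter (fun a => G.Adj a.1 a.2)

theorem IsPathCycleFactor.eq_of_fst_eq {F : Finset (V × V)} (hF : IsPathCycleFactor F)
    {a b : V × V} (ha : a ∈ F) (hb : b ∈ F) (h : a.1 = b.1) : a = b :=
  Finset.card_le_one.mp (hF b.1).1 a (by simp [ha, h]) b (by simp [hb])

theorem IsPathCycleFactor.eq_of_snd_eq {F : Finset (V × V)} (hF : IsPathCycleFactor F)
    {a b : V × V} (ha : a ∈ F) (hb : b ∈ F) (h : a.2 = b.2) : a = b :=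
  Finset.card_le_one.mp (hF b.2).2 a (by simp [ha, h]) b (by simp [hb])

/-- Iterating `s` for `k` steps from `u` follows arcs of `F` and ends at `v`. -/
def FollowsArcs (F : Finset (V × V)) (s : V → V) (k : ℕ) (u v : V) : Prop :=
  s^[k] u = v ∧ ∀ j < k, (s^[j] u, s^[j + 1] u) ∈ F

theorem FollowsArcs.snoc {F : Finset (V × V)} {s : V → V} (hs : ∀ u v, (u, v) ∈ F → s u = v)
    {k : ℕ} {u v x : V} (h : FollowsArcs F s k u v) (hx : (v, x) ∈ F) :
    FollowsArcs F s (k + 1) u x := by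
  obtain ⟨rfl, h⟩ := h
  have hsx := hs _ _ hx
  refine ⟨by rw [Function.iterate_succ_apply', hsx], fun j hj => ?_⟩
  rcases Nat.lt_succ_iff_lt_or_eq.mp hj with hj | rfl
  · exact h j hj
  · rwa [Function.iterate_succ_apply', hsx]

theorem FollowsArcs.cons {F : Finset (V × V)} {s : V → V} (hs : ∀ u v, (u, v) ∈ F → s u = v)
    {k : ℕ} {u v x : V} (h : FollowsArcs F s k u v) (hx : (x, u) ∈ F) :
    FollowsArcs F s (k + 1) x v := by
  obtain ⟨rfl, h⟩ := h
  have hsx := hs _ _ hx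
  refine ⟨by rw [Function.iterate_succ_apply, hsx], fun j hj => ?_⟩
  cases j with
  | zero => simpa [hsx] using hx
  | succ j =>
    have := h j (by omega)
    rwa [Function.iterate_succ_apply s j x, Function.iterate_succ_apply s (j + 1) x, hsx]

theorem FollowsArcs.dropLast {F : Finset (V × V)} {s : V → V} (hF : IsPathCycleFactor F)
    {k : ℕ} {u v x : V} (h : FollowsArcs F s (k + 1) u v) (hx : (x, v) ∈ F) :
    FollowsArcs F s k u x := by
  obtain ⟨rfl, h⟩ := h
  have := hF.eq_of_snd_eq (h k (by omega)) hx rfl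
  exact ⟨congrArg Prod.fst this, fun j hj => h j (by omega)⟩

theorem FollowsArcs.dropFirst {F : Finset (V × V)} {s : V → V} (hs : ∀ u v, (u, v) ∈ F → s u = v)
    {k : ℕ} {u v x : V} (h : FollowsArcs F s (k + 1) u v) (hx : (u, x) ∈ F) :
    FollowsArcs F s k x v := by
  obtain ⟨rfl, h⟩ := h
  have hsx := hs _ _ hx
  refine ⟨by rw [Function.iterate_succ_apply, hsx], fun j hj => ?_⟩
  have := h (j + 1) (by omega)
  rwa [Function.iterate_succ_apply s j u, Function.iterate_succ_apply s (j + 1) u, hsx] at this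

theorem exists_successor {F : Finset (V × V)} (hF : IsPathCycleFactor F) :
    ∃ s : V → V, ∀ u v, (u, v) ∈ F → s u = v := by
  refine ⟨fun u => if h : ∃ v, (u, v) ∈ F then h.choose else u, fun u v huv => ?_⟩
  have h : ∃ v, (u, v) ∈ F := ⟨v, huv⟩
  simp only [dif_pos h]
  exact congrArg Prod.snd (hF.eq_of_fst_eq h.choose_spec huv rfl)

/-- The endpoints of an undirected walk in a path-cycle factor are joined by a directed walk
of the same parity, in one direction or the other. -/
theorem exists_followsArcs_of_walk {F : Finset (V × V)} {s : V → V} (hF : IsPathCycleFactor F)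
    (hs : ∀ u v, (u, v) ∈ F → s u = v) {u v : V}
    (p : (SimpleGraph.fromRel fun a b => (a, b) ∈ F).Walk u v) :
    ∃ k, k % 2 = p.length % 2 ∧ (FollowsArcs F s k u v ∨ FollowsArcs F s k v u) := by
  induction p with
  | nil => exact ⟨0, rfl, Or.inl ⟨rfl, by simp⟩⟩
  | @cons x u v hxu p ih =>
    have hnil : FollowsArcs F s 0 x x := ⟨rfl, by simp⟩
    obtain ⟨k, hk, h⟩ := ih
    rw [SimpleGraph.Walk.length_cons]
    rcases hxu.2 with hx | hx <;> rcases h with h | h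
    · exact ⟨k + 1, by omega, Or.inl (h.cons hs hx)⟩
    · cases k with
      | zero =>
        obtain rfl : v = u := h.1
        exact ⟨1, by omega, Or.inl (hnil.snoc hs hx)⟩
      | succ k => exact ⟨k, by omega, Or.inr (h.dropLast hF hx)⟩
    · cases k with
      | zero =>
        obtain rfl : u = v := h.1
        exact ⟨1, by omega, Or.inr (hnil.cons hs hx)⟩
      | succ k => exact ⟨k, by omega, Or.inl (h.dropFirst hs hx)⟩
    · exact ⟨k + 1, by omega, Or.inr (h.snoc hs hx)⟩

theorem FollowsArcs.hasOddDicycle {F : Finset (V × V)} {s : V → V} {k : ℕ} {u : V}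
    (h : FollowsArcs F s k u u) (hk : Odd k) : HasOddDicycle F := by
  have hper : Function.IsPeriodicPt s k u := h.1
  have hm := hper.minimalPeriod_pos hk.pos
  have hle := hper.minimalPeriod_le hk.pos
  have hodd : Odd (Function.minimalPeriod s u) := hk.of_dvd_nat hper.minimalPeriod_dvd
  have : NeZero (Function.minimalPeriod s u) := ⟨hm.ne'⟩
  refine ⟨Function.minimalPeriod s u, fun i => s^[i.val] u, hm, hodd, fun i j hij => ?_,
    fun i => ?_⟩
  · exact ZMod.val_injective _
      (Function.iterate_injOn_Iio_minimalPeriod (ZMod.val_lt i) (ZMod.val_lt j) hij)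
  · have hsucc : s^[(i + 1).val] u = s^[i.val + 1] u := by
      have hval : (i + 1).val = (i.val + 1) % Function.minimalPeriod s u := by
        rw [← ZMod.val_natCast]
        simp
      rw [hval, Function.iterate_mod_minimalPeriod_eq]
    simp only [hsucc]
    exact h.2 _ ((ZMod.val_lt i).trans_le hle)

/-- The vertices can be 2-coloured so that the ends of every arc of an even factor differ. -/
theorem IsEvenFactor.exists_coloring {F : Finset (V × V)} (hF : IsEvenFactor F) :
    ∃ f : V → Fin 2, ∀ u v, (u, v) ∈ F → u ≠ v → f u ≠ f v := by
  obtain ⟨s, hs⟩ := exists_successor hF.1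
  have hcol : (SimpleGraph.fromRel fun a b => (a, b) ∈ F).Colorable 2 := by
    rw [SimpleGraph.two_colorable_iff_forall_loop_even]
    intro u p
    by_contra hp
    obtain ⟨k, hk, h⟩ := exists_followsArcs_of_walk hF.1 hs p
    have hodd : Odd k := by
      rw [Nat.not_even_iff] at hp
      rw [Nat.odd_iff, hk, hp]
    exact hF.2 ((h.elim id id).hasOddDicycle hodd)
  obtain ⟨f⟩ := hcol
  exact ⟨f, fun u v huv hne => f.valid ⟨hne, Or.inl huv⟩⟩

/-- For every even factor `F ⊆ A` of the digraph `D = (V, A)` obtained from `G`,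
there exists a matching `M` of `G` with `w(M) ≥ w'(F)/2`. -/
theorem even_factor_to_matching (G : SimpleGraph V) (w : Sym2 V → ℝ)
    (F : Finset (V × V)) (hFA : F ⊆ digraphArcs G) (hF : IsEvenFactor F) :
    ∃ M : Finset (Sym2 V), M ⊆ G.edgeFinset ∧
      (∀ v : V, (M.filter (fun e => v ∈ e)).card ≤ 1) ∧
      (∑ e ∈ M, w e) ≥ (∑ a ∈ F, w s(a.1, a.2)) / 2 := by
  obtain ⟨f, hf⟩ := hF.exists_coloring
  have hadj : ∀ a ∈ F, G.Adj a.1 a.2 := fun a ha => by simpa [digraphArcs] using hFA ha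
  have hfa : ∀ a ∈ F, f a.1 ≠ f a.2 := fun a ha => hf a.1 a.2 ha (hadj a ha).ne
  have huniq : ∀ a ∈ F, ∀ b ∈ F, f a.1 = f b.1 → ∀ v : V, v ∈ s(a.1, a.2) → v ∈ s(b.1, b.2) →
      a = b := by
    intro a ha b hb hab v hva hvb
    rcases Sym2.mem_iff.mp hva with h1 | h1 <;> rcases Sym2.mem_iff.mp hvb with h2 | h2
    · exact hF.1.eq_of_fst_eq ha hb (h1.symm.trans h2)
    · exact absurd (by rw [← hab, ← h1, h2]) (hfa b hb)
    · exact absurd (by rw [hab, ← h2, h1]) (hfa a ha)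
    · exact hF.1.eq_of_snd_eq ha hb (h1.symm.trans h2)
  have hsum : ∑ i : Fin 2, ∑ a ∈ F with f a.1 = i, w s(a.1, a.2) = ∑ a ∈ F, w s(a.1, a.2) :=
    Finset.sum_fiberwise F (fun a => f a.1) _
  rw [Fin.sum_univ_two] at hsum
  obtain ⟨i, hi⟩ : ∃ i : Fin 2,
      (∑ a ∈ F with f a.1 = i, w s(a.1, a.2)) ≥ (∑ a ∈ F, w s(a.1, a.2)) / 2 := by
    by_contra! hcon
    linarith [hcon 0, hcon 1]
  refine ⟨(F.filter fun a => f a.1 = i).image fun a => s(a.1, a.2), ?_, fun v => ?_, ?_⟩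
  · intro e he
    obtain ⟨a, ha, rfl⟩ := Finset.mem_image.mp he
    simpa using hadj a (Finset.mem_filter.mp ha).1
  · rw [Finset.card_le_one]
    intro e he e' he'
    obtain ⟨he, hve⟩ := Finset.mem_filter.mp he
    obtain ⟨he', hve'⟩ := Finset.mem_filter.mp he'
    obtain ⟨a, ha, rfl⟩ := Finset.mem_image.mp he
    obtain ⟨b, hb, rfl⟩ := Finset.mem_image.mp he'
    obtain ⟨ha, hai⟩ := Finset.mem_filter.mp ha
    obtain ⟨hb, hbi⟩ := Finset.mem_filter.mp hb
    rw [huniq a ha b hb (hai.trans hbi.symm) v hve hve']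
  · rw [Finset.sum_image]
    · exact hi
    · intro a ha b hb hab
      obtain ⟨ha, hai⟩ := Finset.mem_filter.mp ha
      obtain ⟨hb, hbi⟩ := Finset.mem_filter.mp hb
      have hab : s(a.1, a.2) = s(b.1, b.2) := hab
      exact huniq a ha b hb (hai.trans hbi.symm) a.1 (Sym2.mem_mk_left _ _)
        (hab ▸ Sym2.mem_mk_left _ _)
end
end

section
/- Let G=(V,E) be a finite simple undirected graph with |V| ≥ 3, and let U = { U ⊆ V : 1 ≤ |U| ≤ |V|−1 }. If F ⊆ E is a U-feasible 2-matching with |F| = |V|, then F is the edge set of a Hamilton cycle of G, i.e., F is the edge set of a cycle passing through every vertex of G exactly once. -/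
open scoped Classical

noncomputable section

variable {V : Type*} [Fintype V] [DecidableEq V]

omit [DecidableEq V] in
/-- An acyclic graph on a nonempty finite vertex set has fewer edges than vertices. -/
theorem SimpleGraph.IsAcyclic.card_edgeFinset_lt [Nonempty V] {H : SimpleGraph V}
    [Fintype H.edgeSet] (hH : H.IsAcyclic) : H.edgeFinset.card < Fintype.card V := by
  obtain ⟨T, hHT, -, hT⟩ :=
    SimpleGraph.connected_top.exists_isTree_le_of_le_of_isAcyclic (le_top : H ≤ ⊤) hH
  have hle : H.edgeFinset.card ≤ T.edgeFinset.card :=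
    Finset.card_le_card (SimpleGraph.edgeFinset_subset_edgeFinset.mpr hHT)
  have := hT.card_edgeFinset
  lia

omit [Fintype V] in
theorem SimpleGraph.Walk.IsCycle.card_support_toFinset {H : SimpleGraph V} {v : V}
    {p : H.Walk v v} (hp : p.IsCycle) : p.support.toFinset.card = p.length := by
  have hmem : v ∈ p.support.tail := p.end_mem_tail_support hp.not_nil
  rw [← p.cons_tail_support, List.toFinset_cons, Finset.insert_eq_of_mem (by simpa using hmem),
    List.toFinset_card_of_nodup hp.support_nodup]
  simp

omit [Fintype V] [DecidableEq V] in
theorem ufBound_two (U : Finset V) : ufBound 2 U = (U.card : ℤ) - 1 := by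
  rw [ufBound, Int.floor_eq_iff]
  push_cast
  constructor <;> linarith

/-- Let `𝒰 = { U ⊆ V : 1 ≤ |U| ≤ |V|−1 }` and `|V| ≥ 3`. If `F` is a `𝒰`-feasible
`2`-matching with `|F| = |V|`, then `F` is the edge set of a Hamilton cycle of `G`. -/
theorem feasible_two_matching_is_hamilton_cycle (G : SimpleGraph V)
    (hV : 3 ≤ Fintype.card V)
    (F : Finset (Sym2 V)) (hFE : F ⊆ G.edgeFinset) (hFmatch : IsTMatching F 2)
    (hFfeas : IsUFeasible F
      ((Finset.univ : Finset (Finset V)).filter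
        (fun U => 1 ≤ U.card ∧ U.card ≤ Fintype.card V - 1)) 2)
    (hcard : F.card = Fintype.card V) :
    ∃ (v : V) (p : G.Walk v v), p.IsHamiltonianCycle ∧ F = p.edges.toFinset := by
  have : Nonempty V := Fintype.card_pos_iff.mp (by lia)
  have hFG : ∀ e ∈ F, e ∈ G.edgeSet := fun e he ↦ SimpleGraph.mem_edgeFinset.mp (hFE he)
  set H : SimpleGraph V := SimpleGraph.fromEdgeSet (F : Set (Sym2 V)) with hH
  have hHG : H ≤ G := by
    rw [hH, SimpleGraph.fromEdgeSet_le]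
    exact fun e he ↦ hFG e he.1
  have hedge : ∀ e, e ∈ H.edgeSet ↔ e ∈ F := by
    intro e
    rw [hH, SimpleGraph.edgeSet_fromEdgeSet]
    exact ⟨fun h ↦ h.1, fun h ↦ ⟨h, G.not_isDiag_of_mem_edgeSet (hFG e h)⟩⟩
  have hHF : H.edgeFinset = F := by
    ext e
    rw [SimpleGraph.mem_edgeFinset, hedge]
  have hcyc : ¬ H.IsAcyclic := fun h ↦ by
    have := h.card_edgeFinset_lt
    rw [hHF] at this
    lia
  simp only [SimpleGraph.IsAcyclic, not_forall, not_not] at hcyc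
  obtain ⟨v, p, hp⟩ := hcyc
  have hpF : p.edges.toFinset ⊆ F := fun e he ↦
    (hedge e).mp (p.edges_subset_edgeSet (List.mem_toFinset.mp he))
  have hpcard : p.edges.toFinset.card = p.length := by
    rw [List.toFinset_card_of_nodup hp.edges_nodup, p.length_edges]
  have hlen : p.length = Fintype.card V := by
    by_contra hne
    have hsupp := hp.card_support_toFinset
    have hle : p.support.toFinset.card ≤ Fintype.card V := Finset.card_le_univ _
    have hthree := hp.three_le_length
    have hfeas := hFfeas p.support.toFinset
      (Finset.mem_filter.mpr ⟨Finset.mem_univ _, by lia, by lia⟩)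
    have hsub : p.edges.toFinset ⊆ inducedEdges F p.support.toFinset := fun e he ↦
      Finset.mem_filter.mpr ⟨hpF he, fun w hw ↦ List.mem_toFinset.mpr
        (SimpleGraph.Walk.mem_support_of_mem_edges (List.mem_toFinset.mp he) hw)⟩
    have := Finset.card_le_card hsub
    rw [ufBound_two] at hfeas
    lia
  refine ⟨v, p.mapLe hHG, ?_, ?_⟩
  · rw [SimpleGraph.Walk.isHamiltonianCycle_iff_isCycle_and_length_eq]
    exact ⟨hp.mapLe hHG, by simpa [SimpleGraph.Walk.mapLe] using hlen⟩
  · rw [SimpleGraph.Walk.edges_mapLe_eq_edges]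
    exact (Finset.eq_of_subset_of_card_le hpF (by lia)).symm
end
end
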